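/- An n-qubit state ψ is locally maximally entanglable (LME) if and only if there exist 2×2 unitary matrices U₁,…,Uₙ such that the 2^n vectors U₁^{i₁} ⊗ U₂^{i₂} ⊗ ⋯ ⊗ Uₙ^{iₙ} ψ, indexed by (i₁,…,iₙ) ∈ {0,1}ⁿ (where U⁰ = identity and U¹ = U), form an orthonormal basis of ℂ^{2^n}. -/

import Mathlib

open Complex

noncomputable section

/-- Identify a bit with an index into `Fin 2`. -/
def bIdx (b : Bool) : Fin 2 := if b then 1 else 0

/-- The action of the tensor product `U 0 ⊗ U 1 ⊗ ⋯ ⊗ U (n-1)` of 2×2 matrices on an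
`n`-qubit vector `ψ : (Fin n → Bool) → ℂ`. -/
def tensorAction {n : ℕ} (U : Fin n → Matrix (Fin 2) (Fin 2) ℂ)
    (ψ : (Fin n → Bool) → ℂ) : (Fin n → Bool) → ℂ :=
  fun i => ∑ j : Fin n → Bool, (∏ k, U k (bIdx (i k)) (bIdx (j k))) * ψ j

/-- The standard Hermitian inner product on `ℂ^ι`. -/
def hinner {ι : Type*} [Fintype ι] (ψ φ : ι → ℂ) : ℂ :=
  ∑ i, (starRingEnd ℂ) (ψ i) * φ i

/-- `U^b` for a bit `b`: the identity if `b = 0`, and `U` if `b = 1`. -/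
def bpow (U : Matrix (Fin 2) (Fin 2) ℂ) (b : Bool) : Matrix (Fin 2) (Fin 2) ℂ :=
  if b then U else 1

/-- `ψ` is locally maximally entanglable: there are controlled unitaries
`C_l = U_l^{(0)} ⊗ |0⟩⟨0| + U_l^{(1)} ⊗ |1⟩⟨1|` (one per site, each acting on system qubit `l`
and its private ancilla) such that the `2n`-qubit state `(C₁ ⊗ ⋯ ⊗ Cₙ)(ψ ⊗ |+⟩^{⊗n})`,
whose amplitude at (system index `i`, ancilla index `a`) is
`(1/√2)^n ⋅ (U₁^{(a₁)} ⊗ ⋯ ⊗ Uₙ^{(aₙ)} ψ)(i)`, has reduced density matrix on the `n`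
system qubits equal to `2^{-n}` times the identity. -/
def IsLME {n : ℕ} (ψ : (Fin n → Bool) → ℂ) : Prop :=
  ∃ U : Fin n → Bool → Matrix (Fin 2) (Fin 2) ℂ,
    (∀ k b, U k b ∈ Matrix.unitaryGroup (Fin 2) ℂ) ∧
    ∀ i i' : Fin n → Bool,
      (∑ a : Fin n → Bool,
        ((Real.sqrt 2 : ℂ)⁻¹ ^ n * tensorAction (fun k => U k (a k)) ψ i) *
          (starRingEnd ℂ) ((Real.sqrt 2 : ℂ)⁻¹ ^ n * tensorAction (fun k => U k (a k)) ψ i')) =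
      if i = i' then ((2 : ℂ) ^ n)⁻¹ else 0

/-- The Kronecker product of a family of 2×2 matrices, indexed by bit strings. -/
def tensorMatrix {n : ℕ} (U : Fin n → Matrix (Fin 2) (Fin 2) ℂ) :
    Matrix (Fin n → Bool) (Fin n → Bool) ℂ :=
  Matrix.of fun i j => ∏ k, U k (bIdx (i k)) (bIdx (j k))

theorem tensorAction_eq_mulVec {n : ℕ} (U : Fin n → Matrix (Fin 2) (Fin 2) ℂ)
    (ψ : (Fin n → Bool) → ℂ) : tensorAction U ψ = (tensorMatrix U).mulVec ψ :=
  rfl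

theorem hinner_eq_dotProduct {ι : Type*} [Fintype ι] (ψ φ : ι → ℂ) :
    hinner ψ φ = star ψ ⬝ᵥ φ :=
  rfl

theorem sum_bIdx (f : Fin 2 → ℂ) : ∑ b : Bool, f (bIdx b) = ∑ i, f i := by
  simp [bIdx, Fin.sum_univ_two, add_comm]

theorem bIdx_injective : Function.Injective bIdx := by
  decide

theorem tensorMatrix_mul {n : ℕ} (A B : Fin n → Matrix (Fin 2) (Fin 2) ℂ) :
    tensorMatrix (fun k => A k * B k) = tensorMatrix A * tensorMatrix B := by
  ext i j
  simp only [tensorMatrix, Matrix.of_apply, Matrix.mul_apply, ← Finset.prod_mul_distrib]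
  simp only [← sum_bIdx, Finset.prod_univ_sum, Fintype.piFinset_univ]

theorem tensorMatrix_one {n : ℕ} :
    tensorMatrix (fun _ : Fin n => (1 : Matrix (Fin 2) (Fin 2) ℂ)) = 1 := by
  ext i j
  simp [tensorMatrix, Matrix.one_apply, bIdx_injective.eq_iff, Finset.prod_ite_zero, funext_iff]

theorem tensorMatrix_conjTranspose {n : ℕ} (A : Fin n → Matrix (Fin 2) (Fin 2) ℂ) :
    tensorMatrix (fun k => (A k).conjTranspose) = (tensorMatrix A).conjTranspose := by
  ext i j
  simp [tensorMatrix, Matrix.conjTranspose_apply]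

/-- A tensor product of local unitaries preserves inner products. -/
theorem hinner_tensorAction_mul {n : ℕ} {A : Fin n → Matrix (Fin 2) (Fin 2) ℂ}
    (hA : ∀ k, A k ∈ Matrix.unitaryGroup (Fin 2) ℂ) (B C : Fin n → Matrix (Fin 2) (Fin 2) ℂ)
    (ψ φ : (Fin n → Bool) → ℂ) :
    hinner (tensorAction (fun k => A k * B k) ψ) (tensorAction (fun k => A k * C k) φ) =
      hinner (tensorAction B ψ) (tensorAction C φ) := by
  have hU : (tensorMatrix A).conjTranspose * tensorMatrix A = 1 := by
    rw [← tensorMatrix_conjTranspose, ← tensorMatrix_mul, ← tensorMatrix_one]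
    congr 1
    funext k
    exact Matrix.mem_unitaryGroup_iff'.mp (hA k)
  simp only [tensorAction_eq_mulVec, hinner_eq_dotProduct, tensorMatrix_mul,
    ← Matrix.mulVec_mulVec]
  rw [Matrix.star_mulVec, ← Matrix.dotProduct_mulVec, Matrix.mulVec_mulVec, hU, Matrix.one_mulVec]

/-- The matrix whose columns are the vectors `v s`. -/
def columnMatrix {ι : Type*} (v : ι → ι → ℂ) : Matrix ι ι ℂ :=
  Matrix.of fun i s => v s i

theorem conjTranspose_mul_columnMatrix_eq_one_iff {ι : Type*} [Fintype ι] [DecidableEq ι]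
    (v : ι → ι → ℂ) :
    (columnMatrix v).conjTranspose * columnMatrix v = 1 ↔
      ∀ s t, hinner (v s) (v t) = if s = t then 1 else 0 := by
  rw [← Matrix.ext_iff]
  rfl

theorem span_range_eq_top_of_orthonormal {ι : Type*} [Fintype ι] [DecidableEq ι]
    {v : ι → ι → ℂ} (h : ∀ s t, hinner (v s) (v t) = if s = t then 1 else 0) :
    Submodule.span ℂ (Set.range v) = ⊤ := by
  have hM := mul_eq_one_comm.mp ((conjTranspose_mul_columnMatrix_eq_one_iff v).mpr h)
  change Submodule.span ℂ (Set.range (columnMatrix v).col) = ⊤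
  rw [← Matrix.range_mulVecLin, LinearMap.range_eq_top]
  intro w
  exact ⟨(columnMatrix v).conjTranspose.mulVec w, by simp [Matrix.mulVec_mulVec, hM]⟩

/-- The reduced state is maximally mixed iff the branch vectors are orthonormal. -/
theorem reduced_eq_iff_orthonormal {n : ℕ} (v : (Fin n → Bool) → (Fin n → Bool) → ℂ) :
    (∀ i i' : Fin n → Bool,
      (∑ a : Fin n → Bool,
        ((Real.sqrt 2 : ℂ)⁻¹ ^ n * v a i) *
          (starRingEnd ℂ) ((Real.sqrt 2 : ℂ)⁻¹ ^ n * v a i')) =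
      if i = i' then ((2 : ℂ) ^ n)⁻¹ else 0) ↔
      ∀ s t, hinner (v s) (v t) = if s = t then 1 else 0 := by
  rw [← conjTranspose_mul_columnMatrix_eq_one_iff, mul_eq_one_comm, ← Matrix.ext_iff]
  refine forall₂_congr fun i i' => ?_
  have h2 : (Real.sqrt 2 : ℂ)⁻¹ ^ n * (Real.sqrt 2 : ℂ)⁻¹ ^ n = ((2 : ℂ) ^ n)⁻¹ := by
    rw [← mul_pow, ← mul_inv, ← ofReal_mul, Real.mul_self_sqrt zero_le_two, inv_pow]
    norm_num
  have hsum : (∑ a : Fin n → Bool,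
      ((Real.sqrt 2 : ℂ)⁻¹ ^ n * v a i) *
        (starRingEnd ℂ) ((Real.sqrt 2 : ℂ)⁻¹ ^ n * v a i')) =
      ((2 : ℂ) ^ n)⁻¹ * (columnMatrix v * (columnMatrix v).conjTranspose) i i' := by
    rw [Matrix.mul_apply, Finset.mul_sum]
    refine Finset.sum_congr rfl fun a _ => ?_
    simp only [columnMatrix, Matrix.of_apply, Matrix.conjTranspose_apply, map_mul, map_pow,
      map_inv₀, conj_ofReal, ← h2]
    rw [starRingEnd_apply]
    ring
  have hne : ((2 : ℂ) ^ n)⁻¹ ≠ 0 := inv_ne_zero (pow_ne_zero n two_ne_zero)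
  rw [hsum, Matrix.one_apply]
  split_ifs <;> simp [hne]

/-- Lemma 1: an `n`-qubit state `ψ` is LME iff there exist 2×2 unitaries
`U₁, …, Uₙ` such that the `2^n` vectors `U₁^{i₁} ⊗ ⋯ ⊗ Uₙ^{iₙ} ψ` form an orthonormal
basis of `ℂ^{2^n}`. -/
theorem lme_iff_extendable_to_onbasis (n : ℕ) (ψ : (Fin n → Bool) → ℂ)
    (hψ : hinner ψ ψ = 1) :
    IsLME ψ ↔
      ∃ U : Fin n → Matrix (Fin 2) (Fin 2) ℂ,
        (∀ k, U k ∈ Matrix.unitaryGroup (Fin 2) ℂ) ∧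
        (∀ s t : Fin n → Bool,
          hinner (tensorAction (fun k => bpow (U k) (s k)) ψ)
                 (tensorAction (fun k => bpow (U k) (t k)) ψ) =
            if s = t then 1 else 0) ∧
        Submodule.span ℂ (Set.range fun s : Fin n → Bool =>
          tensorAction (fun k => bpow (U k) (s k)) ψ) = ⊤ := by
  constructor
  · rintro ⟨U, hU, h⟩
    have hortho := (reduced_eq_iff_orthonormal
      fun a => tensorAction (fun k => U k (a k)) ψ).mp h
    have hfactor : ∀ s : Fin n → Bool, (fun k => U k (s k)) =
        fun k => U k false * bpow (star (U k false) * U k true) (s k) := by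
      intro s
      funext k
      cases s k
      · simp [bpow]
      · simp [bpow, ← mul_assoc, Matrix.mem_unitaryGroup_iff.mp (hU k false)]
    have hbranch : ∀ s t : Fin n → Bool,
        hinner (tensorAction (fun k => bpow (star (U k false) * U k true) (s k)) ψ)
          (tensorAction (fun k => bpow (star (U k false) * U k true) (t k)) ψ) =
        if s = t then 1 else 0 := by
      intro s t
      rw [← hortho s t, hfactor s, hfactor t, hinner_tensorAction_mul fun k => hU k false]
    exact ⟨fun k => star (U k false) * U k true,
      fun k => mul_mem (Unitary.star_mem (hU k false)) (hU k true), hbranch,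
      span_range_eq_top_of_orthonormal hbranch⟩
  · rintro ⟨U, hU, hortho, -⟩
    refine ⟨fun k => bpow (U k), fun k b => ?_, (reduced_eq_iff_orthonormal
      fun a => tensorAction (fun k => bpow (U k) (a k)) ψ).mpr hortho⟩
    cases b
    · exact one_mem _
    · exact hU k
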